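/- Assume that min_{u∈U} f(u) = max_{x∈X} g(x) =: f*, and let x* denote the unique maximizer of g over X. If (u_k)_{k≥0} is a sequence in U with f(u_k) → f* as k → ∞, then x(u_k) → x* and f(u_k) − g(x(u_k)) → 0 as k → ∞. -/

import Mathlib

open Filter Topology

/-- The marginal infimum of a jointly continuous function over a compact set is continuous. -/
theorem continuousOn_sInf_image_of_isCompact {E F : Type*} [TopologicalSpace E]
    [TopologicalSpace F] {X : Set E} {U : Set F} {φ : E → F → ℝ} (hU : IsCompact U)
    (hcont : ContinuousOn (fun p : E × F => φ p.1 p.2) (X ×ˢ U)) :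
    ContinuousOn (fun x => sInf ((fun u => φ x u) '' U)) X := by
  have : CompactSpace U := isCompact_iff_compactSpace.mp hU
  rw [continuousOn_iff_continuous_domRestrict]
  have hφ : Continuous (fun p : X × U => φ p.1 p.2) :=
    hcont.comp_continuous (f := fun p : X × U => ((p.1 : E), (p.2 : F))) (by fun_prop)
      fun p => ⟨p.1.2, p.2.2⟩
  have h := isCompact_univ.continuous_sInf (f := fun (x : X) (u : U) => φ x u) hφ
  simp only [Set.image_univ] at h
  simpa only [Set.image_eq_range, Set.domRestrict_def] using h

/-- Theorem 2.5: if `f(u_k) → f*`, then the primal iterates `x(u_k)` converge to the unique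
primal optimal solution `x*`, and the duality gap `f(u_k) - g(x(u_k))` tends to `0`. -/
theorem primal_iterates_convergence
    {E F : Type*} [NormedAddCommGroup E] [InnerProductSpace ℝ E] [FiniteDimensional ℝ E]
    [NormedAddCommGroup F] [InnerProductSpace ℝ F] [FiniteDimensional ℝ F]
    (X : Set E) (U : Set F) (φ : E → F → ℝ)
    (hXne : X.Nonempty) (hXconv : Convex ℝ X) (hXcomp : IsCompact X)
    (hUne : U.Nonempty) (hUconv : Convex ℝ U) (hUcomp : IsCompact U)
    (hcont : ContinuousOn (fun p : E × F => φ p.1 p.2) (X ×ˢ U))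
    (hconc : ∀ u ∈ U, StrictConcaveOn ℝ X (fun x => φ x u))
    (hconv : ∀ x ∈ X, ConvexOn ℝ U (fun u => φ x u))
    (g : E → ℝ) (hg : ∀ x, g x = sInf ((fun u => φ x u) '' U))
    (f : F → ℝ) (hf : ∀ u, f u = sSup ((fun x => φ x u) '' X))
    (xopt : F → E)
    (hxopt : ∀ u ∈ U, xopt u ∈ X ∧ IsMaxOn (fun x => φ x u) X (xopt u))
    (hxoptu : ∀ u ∈ U, ∀ x' ∈ X, IsMaxOn (fun x => φ x u) X x' → x' = xopt u)
    (fstar : ℝ) (hmin : IsLeast (f '' U) fstar) (hmax : IsGreatest (g '' X) fstar)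
    (xstar : E) (hxstar : xstar ∈ X) (hxstarmax : IsMaxOn g X xstar)
    (hxstaru : ∀ x' ∈ X, IsMaxOn g X x' → x' = xstar)
    (u : ℕ → F) (hu : ∀ k, u k ∈ U)
    (hfconv : Filter.Tendsto (fun k => f (u k)) Filter.atTop (nhds fstar)) :
    Filter.Tendsto (fun k => xopt (u k)) Filter.atTop (nhds xstar) ∧
      Filter.Tendsto (fun k => f (u k) - g (xopt (u k))) Filter.atTop (nhds 0) := by
  have hfval : ∀ v ∈ U, f v = φ (xopt v) v := fun v hv => by
    rw [hf]
    refine IsGreatest.csSup_eq ⟨⟨xopt v, (hxopt v hv).1, rfl⟩, ?_⟩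
    rintro _ ⟨x, hx, rfl⟩
    exact (hxopt v hv).2 hx
  have hgstar : g xstar = fstar := by
    obtain ⟨x, hx, hgx⟩ := hmax.1
    exact le_antisymm (hmax.2 ⟨xstar, hxstar, rfl⟩) (hgx ▸ hxstarmax hx)
  have hstar_le : ∀ v ∈ U, fstar ≤ φ xstar v := fun v hv => by
    have hφ : ContinuousOn (fun v => φ xstar v) U :=
      hcont.comp (f := fun v => (xstar, v)) (by fun_prop) fun v hv => ⟨hxstar, hv⟩
    rw [← hgstar, hg]
    exact csInf_le (hUcomp.image_of_continuousOn hφ).bddBelow ⟨v, hv, rfl⟩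
  have hlim : Tendsto (fun k => xopt (u k)) atTop (𝓝 xstar) := by
    refine tendsto_of_subseq_tendsto fun ns hns => ?_
    obtain ⟨⟨x, v⟩, ⟨hx, hv⟩, ms, hms, hxv⟩ := (hXcomp.prod hUcomp).tendsto_subseq
      (x := fun n => (xopt (u (ns n)), u (ns n))) fun n => ⟨(hxopt _ (hu _)).1, hu _⟩
    simp only [Function.comp_def, Prod.tendsto_iff] at hxv
    obtain ⟨hlx, hlv⟩ := hxv
    have htendsto : ∀ (y : ℕ → E) (z : E), (∀ n, y n ∈ X) → z ∈ X → Tendsto y atTop (𝓝 z) →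
        Tendsto (fun n => φ (y n) (u (ns (ms n)))) atTop (𝓝 (φ z v)) := fun y z hy hz hyz =>
      (hcont (z, v) ⟨hz, hv⟩).tendsto.comp <| tendsto_nhdsWithin_iff.mpr
        ⟨hyz.prodMk_nhds hlv, .of_forall fun n => ⟨hy n, hu _⟩⟩
    have hφx := htendsto _ x (fun n => (hxopt _ (hu (ns (ms n)))).1) hx hlx
    have hmaxx : IsMaxOn (fun x => φ x v) X x := fun y hy =>
      le_of_tendsto_of_tendsto' (htendsto (fun _ => y) y (fun _ => hy) hy tendsto_const_nhds)
        hφx fun n => (hxopt _ (hu _)).2 hy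
    have hval : φ x v = fstar := by
      refine tendsto_nhds_unique hφx ?_
      simpa only [Function.comp_def, hfval _ (hu _)] using
        hfconv.comp (hns.comp hms.tendsto_atTop)
    have hmaxstar : IsMaxOn (fun x => φ x v) X xstar := fun y hy =>
      (hmaxx hy).trans (hval.le.trans (hstar_le v hv))
    have hxeq : x = xstar := (hxoptu v hv x hx hmaxx).trans
      (hxoptu v hv xstar hxstar hmaxstar).symm
    exact ⟨ms, hxeq ▸ hlx⟩
  refine ⟨hlim, ?_⟩
  have hgcont : ContinuousOn g X := funext hg ▸ continuousOn_sInf_image_of_isCompact hUcomp hcont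
  have hglim : Tendsto (fun k => g (xopt (u k))) atTop (𝓝 fstar) := by
    rw [← hgstar]
    exact (hgcont xstar hxstar).tendsto.comp <| tendsto_nhdsWithin_iff.mpr
      ⟨hlim, .of_forall fun k => (hxopt _ (hu k)).1⟩
  simpa using hfconv.sub hglim
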